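/- Assume −c̄ ∈ cone{a_t : t ∈ T}. Let b, b̄ ∈ dom F with b ≠ b̄, and write B(b̄,b) = {μ_1, μ_2, …, μ_N} with 0 := μ_0 < μ_1 < μ_2 < … < μ_N < μ_{N+1} := 1. Then for every x ∈ F_c̄^op(b) one has d(x, F_c̄^op(b̄))/d(b, b̄) ≤ max{Lipusc F_c̄^op(b̄ + μ_k(b − b̄)) : k = 0,…,N}. -/

import Mathlib

open scoped ENNReal RealInnerProductSpace
open Filter EMetric Set

/-- Calmness modulus of a set-valued mapping `M` at `(ybar, xbar)`:
`limsup_{x → xbar} d(x, M(ybar)) / d(ybar, M⁻¹(x))`, with conventions `0/0 = 0`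
and `d(·, ∅) = ∞` (automatic in `ℝ≥0∞`). -/
noncomputable def clmMod {Y X : Type*} [PseudoEMetricSpace Y] [PseudoEMetricSpace X]
    (M : Y → Set X) (ybar : Y) (xbar : X) : ℝ≥0∞ :=
  Filter.limsup
    (fun x => EMetric.infEdist x (M ybar) / EMetric.infEdist ybar {y | x ∈ M y}) (nhds xbar)

/-- Lipschitz upper semicontinuity modulus of `M` at `ybar`:
`limsup_{y → ybar} sup_{x ∈ M(y)} d(x, M(ybar)) / d(y, ybar)`. -/
noncomputable def lipuscMod {Y X : Type*} [PseudoEMetricSpace Y] [PseudoEMetricSpace X]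
    (M : Y → Set X) (ybar : Y) : ℝ≥0∞ :=
  Filter.limsup
    (fun y => ⨆ x ∈ M y, EMetric.infEdist x (M ybar) / edist y ybar) (nhds ybar)

/-- Hoffman constant of `M`: `sup_{(y,x) ∈ dom M × X} d(x, M(y)) / d(y, M⁻¹(x))`. -/
noncomputable def hofConst {Y X : Type*} [PseudoEMetricSpace Y] [PseudoEMetricSpace X]
    (M : Y → Set X) : ℝ≥0∞ :=
  ⨆ y ∈ {y | (M y).Nonempty}, ⨆ x : X,
    EMetric.infEdist x (M y) / EMetric.infEdist y {y' | x ∈ M y'}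

/-- The feasible set mapping `F(b) = {x ∈ ℝⁿ : ⟨a_t, x⟩ ≤ b_t for all t ∈ T}`. -/
def Feas {n m : ℕ} (a : Fin m → EuclideanSpace ℝ (Fin n)) (b : Fin m → ℝ) :
    Set (EuclideanSpace ℝ (Fin n)) :=
  {x | ∀ t, ⟪a t, x⟫ ≤ b t}

/-- The optimal set (argmin) mapping `F^op(c,b) = argmin{⟨c,x⟩ : x ∈ F(b)}`. -/
def Fop {n m : ℕ} (a : Fin m → EuclideanSpace ℝ (Fin n)) (c : EuclideanSpace ℝ (Fin n))
    (b : Fin m → ℝ) : Set (EuclideanSpace ℝ (Fin n)) :=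
  {x | x ∈ Feas a b ∧ ∀ y ∈ Feas a b, ⟪c, x⟫ ≤ ⟪c, y⟫}

/-- Active index set `T_b(x) = {t ∈ T : ⟨a_t, x⟩ = b_t}`. -/
def activeSet {n m : ℕ} (a : Fin m → EuclideanSpace ℝ (Fin n)) (b : Fin m → ℝ)
    (x : EuclideanSpace ℝ (Fin n)) : Set (Fin m) :=
  {t | ⟪a t, x⟫ = b t}

/-- `z ∈ cone{a_t : t ∈ D}` (conical convex hull). -/
def InCone {n m : ℕ} (a : Fin m → EuclideanSpace ℝ (Fin n)) (D : Finset (Fin m))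
    (z : EuclideanSpace ℝ (Fin n)) : Prop :=
  ∃ lam : Fin m → ℝ, (∀ t, 0 ≤ lam t) ∧ (∀ t ∉ D, lam t = 0) ∧ z = ∑ t, lam t • a t

/-- The family of minimal KKT index subsets `M_{c,b}`: all `D ⊆ T_b(x)` (for an optimal
point `x ∈ F^op(c,b)`; independent of the choice of `x`) with `−c ∈ cone{a_t : t ∈ D}`,
minimal with respect to inclusion among such subsets. (It is empty when `F^op(c,b) = ∅`.) -/
def Mcb {n m : ℕ} (a : Fin m → EuclideanSpace ℝ (Fin n)) (c : EuclideanSpace ℝ (Fin n))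
    (b : Fin m → ℝ) : Set (Finset (Fin m)) :=
  {D | ∃ x ∈ Fop a c b, (D : Set (Fin m)) ⊆ activeSet a b x ∧ InCone a D (-c) ∧
    ∀ D' ⊆ D, InCone a D' (-c) → D' = D}

/-- The break step set `B(b̄,b)`: points `μ ∈ (0,1)` approachable by a sequence `ν_r → μ`
with `M_{c,b̄+ν_r(b−b̄)} ⊊ M_{c,b̄+μ(b−b̄)}` for all `r`. -/
def BreakSet {n m : ℕ} (a : Fin m → EuclideanSpace ℝ (Fin n)) (c : EuclideanSpace ℝ (Fin n))
    (bbar b : Fin m → ℝ) : Set ℝ :=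
  {μ ∈ Set.Ioo (0 : ℝ) 1 | ∃ ν : ℕ → ℝ, Tendsto ν atTop (nhds μ) ∧
    ∀ r : ℕ, Mcb a c (bbar + ν r • (b - bbar)) ⊂ Mcb a c (bbar + μ • (b - bbar))}

section ConeClosed

variable {ι E : Type*} [NormedAddCommGroup E] [NormedSpace ℝ E]

/-- Conical Carathéodory theorem: every conical combination of a finite family reduces to one of a
linearly independent subfamily. -/
theorem exists_linearIndepOn_conicCombination (v : ι → E) (S : Finset ι) :
    ∀ lam : ι → ℝ, (∀ i ∈ S, 0 ≤ lam i) →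
      ∃ S' ⊆ S, LinearIndepOn ℝ v (S' : Set ι) ∧ ∃ lam' : ι → ℝ, (∀ i ∈ S', 0 ≤ lam' i) ∧
        ∑ i ∈ S, lam i • v i = ∑ i ∈ S', lam' i • v i := by
  classical
  induction S using Finset.strongInduction with
  | H S ih =>
    intro lam hlam
    by_cases hli : LinearIndepOn ℝ v (S : Set ι)
    · exact ⟨S, subset_rfl, hli, lam, hlam, rfl⟩
    obtain ⟨g, hg0, i, hiS, hi⟩ : ∃ g : ι → ℝ, ∑ i ∈ S, g i • v i = 0 ∧ ∃ i ∈ S, 0 < g i := by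
      rw [linearIndepOn_finset_iff] at hli
      push Not at hli
      obtain ⟨g, hg0, i, hiS, hi⟩ := hli
      rcases lt_or_gt_of_ne hi with h | h
      · refine ⟨-g, by simp [hg0], i, hiS, by simpa using h⟩
      · exact ⟨g, hg0, i, hiS, h⟩
    obtain ⟨j, hj, hjmin⟩ := (S.filter (fun i => 0 < g i)).exists_min_image
      (fun i => lam i / g i) ⟨i, by simp [hiS, hi]⟩
    rw [Finset.mem_filter] at hj
    set r := lam j / g j with hr
    have hr0 : 0 ≤ r := div_nonneg (hlam j hj.1) hj.2.le
    have hnonneg : ∀ k ∈ S, 0 ≤ lam k - r * g k := by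
      intro k hk
      rcases lt_or_ge 0 (g k) with h | h
      · have := hjmin k (by simp [hk, h])
        rw [le_div_iff₀ h] at this
        linarith
      · nlinarith [hlam k hk]
    have hzero : lam j - r * g j = 0 := by
      rw [hr, div_mul_cancel₀ _ hj.2.ne', sub_self]
    obtain ⟨S', hS', hind, lam', hlam', hsum⟩ := ih (S.erase j) (Finset.erase_ssubset hj.1)
      (fun k => lam k - r * g k) (fun k hk => hnonneg k (Finset.mem_of_mem_erase hk))
    refine ⟨S', hS'.trans (Finset.erase_subset _ _), hind, lam', hlam', ?_⟩
    rw [← hsum, Finset.sum_erase _ (by rw [hzero, zero_smul])]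
    simp only [sub_smul, mul_smul, Finset.sum_sub_distrib, ← Finset.smul_sum, hg0, smul_zero,
      sub_zero]

theorem isClosed_conicCombinations [Fintype ι] (v : ι → E) :
    IsClosed {z : E | ∃ lam : ι → ℝ, (∀ i, 0 ≤ lam i) ∧ z = ∑ i, lam i • v i} := by
  classical
  have hset : {z : E | ∃ lam : ι → ℝ, (∀ i, 0 ≤ lam i) ∧ z = ∑ i, lam i • v i} =
      ⋃ S ∈ {S : Finset ι | LinearIndepOn ℝ v (S : Set ι)},
        (Fintype.linearCombination ℝ (fun i : S => v i)) '' {lam | ∀ i, 0 ≤ lam i} := by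
    ext z
    simp only [mem_ofPred_eq, mem_iUnion, mem_image, exists_prop, Fintype.linearCombination_apply]
    constructor
    · rintro ⟨lam, hlam, rfl⟩
      obtain ⟨S, -, hS, lam', hlam', hsum⟩ :=
        exists_linearIndepOn_conicCombination v Finset.univ lam (fun i _ => hlam i)
      refine ⟨S, hS, fun i => lam' i, fun i => hlam' i i.2, ?_⟩
      rw [hsum, ← Finset.sum_coe_sort S (fun i => lam' i • v i)]
    · rintro ⟨S, -, lam, hlam, rfl⟩
      refine ⟨fun i => if h : i ∈ S then lam ⟨i, h⟩ else 0, fun i => ?_, ?_⟩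
      · dsimp only
        split_ifs
        · exact hlam _
        · exact le_rfl
      · rw [← Finset.sum_subset (Finset.subset_univ S) (fun i _ hi => by simp [hi]),
          ← Finset.sum_coe_sort S]
        simp
  rw [hset]
  refine (Set.toFinite _).isClosed_biUnion fun S hS => ?_
  have hinj : LinearMap.ker (Fintype.linearCombination ℝ (fun i : S => v i)) = ⊥ := by
    rw [LinearMap.ker_eq_bot]
    exact linearIndependent_iff_injective_fintypeLinearCombination.1 hS
  refine (LinearMap.isClosedEmbedding_of_injective hinj).isClosedMap _ ?_
  simp only [ofPred_forall]
  exact isClosed_iInter fun i => isClosed_le continuous_const (continuous_apply i)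

theorem isClosed_setOf_exists_inner_le [Fintype ι] {n : ℕ} (u : ι → EuclideanSpace ℝ (Fin n)) :
    IsClosed {β : ι → ℝ | ∃ x, ∀ i, ⟪u i, x⟫ ≤ β i} := by
  classical
  refine (congrArg IsClosed (Set.ext fun β => ?_)).mpr (isClosed_conicCombinations (E := ι → ℝ)
    (Sum.elim (fun i => Pi.single i (1 : ℝ))
      (Sum.elim (fun (j : Fin n) i => u i j) (fun (j : Fin n) i => -u i j))))
  simp only [mem_ofPred_eq, Fintype.sum_sum_type, Sum.elim_inl, Sum.elim_inr]
  constructor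
  · rintro ⟨x, hx⟩
    refine ⟨Sum.elim (fun i => β i - ⟪u i, x⟫)
      (Sum.elim (fun j => max (x j) 0) (fun j => max (-x j) 0)), ?_, ?_⟩
    · rintro (i | j | j)
      · simpa using hx i
      · simp
      · simp
    · ext i
      simp only [Sum.elim_inl, Sum.elim_inr, Pi.add_apply, Finset.sum_apply, Pi.smul_apply,
        smul_eq_mul, PiLp.inner_apply, RCLike.inner_apply, conj_trivial, mul_neg,
        Finset.sum_neg_distrib]
      rw [Finset.sum_eq_single i (by intro k _ hk; simp [hk.symm]) (by simp)]
      rw [Pi.single_eq_same, ← sub_eq_add_neg, ← Finset.sum_sub_distrib, mul_one]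
      have : ∀ j, max (x j) 0 * u i j - max (-x j) 0 * u i j = x j * u i j := by
        intro j
        rw [← sub_mul]
        congr 1
        rcases le_total (x j) 0 with h | h <;> simp [h]
      simp [this]
  · rintro ⟨lam, hlam, rfl⟩
    refine ⟨WithLp.toLp 2 fun j => lam (.inr (.inl j)) - lam (.inr (.inr j)), fun i => ?_⟩
    simp only [Pi.add_apply, Finset.sum_apply, Pi.smul_apply,
        smul_eq_mul, PiLp.inner_apply, RCLike.inner_apply, conj_trivial, mul_neg,
        Finset.sum_neg_distrib]
    rw [Finset.sum_eq_single i (by intro k _ hk; simp [hk.symm]) (by simp)]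
    rw [Pi.single_eq_same, ← sub_eq_add_neg, ← Finset.sum_sub_distrib, mul_one]
    simp only [sub_mul]
    linarith [hlam (.inl i)]

end ConeClosed

section LinearProgram

variable {n m : ℕ} {a : Fin m → EuclideanSpace ℝ (Fin n)} {c : EuclideanSpace ℝ (Fin n)}

theorem inner_eq_neg_sum {lam : Fin m → ℝ} (hc : -c = ∑ t, lam t • a t)
    (x : EuclideanSpace ℝ (Fin n)) : ⟪c, x⟫ = -∑ t, lam t * ⟪a t, x⟫ := by
  rw [← neg_neg c, hc, inner_neg_left, sum_inner]
  simp [real_inner_smul_left]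

theorem neg_sum_mul_le_inner {b lam : Fin m → ℝ} (hlam : ∀ t, 0 ≤ lam t)
    (hc : -c = ∑ t, lam t • a t) {x : EuclideanSpace ℝ (Fin n)} (hx : x ∈ Feas a b) :
    -∑ t, lam t * b t ≤ ⟪c, x⟫ := by
  rw [inner_eq_neg_sum hc]
  exact neg_le_neg (Finset.sum_le_sum fun t _ => mul_le_mul_of_nonneg_left (hx t) (hlam t))

theorem inner_eq_neg_sum_mul {b lam : Fin m → ℝ} {D : Finset (Fin m)}
    (hD : ∀ t ∉ D, lam t = 0) (hc : -c = ∑ t, lam t • a t) {x : EuclideanSpace ℝ (Fin n)}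
    (hx : (D : Set (Fin m)) ⊆ activeSet a b x) : ⟪c, x⟫ = -∑ t, lam t * b t := by
  rw [inner_eq_neg_sum hc]
  congr 1
  refine Finset.sum_congr rfl fun t _ => ?_
  by_cases h : t ∈ D
  · rw [show ⟪a t, x⟫ = b t from hx h]
  · simp [hD t h]

theorem mem_Mcb_iff {b : Fin m → ℝ} {D : Finset (Fin m)} :
    D ∈ Mcb a c b ↔ (InCone a D (-c) ∧ ∀ D' ⊆ D, InCone a D' (-c) → D' = D) ∧
      ∃ x ∈ Feas a b, (D : Set (Fin m)) ⊆ activeSet a b x := by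
  constructor
  · rintro ⟨x, hx, hact, hmin⟩
    exact ⟨hmin, x, hx.1, hact⟩
  · rintro ⟨hmin, x, hx, hact⟩
    refine ⟨x, ⟨hx, fun y hy => ?_⟩, hact, hmin⟩
    obtain ⟨lam, h0, hD, hc⟩ := hmin.1
    rw [inner_eq_neg_sum_mul hD hc hact]
    exact neg_sum_mul_le_inner h0 hc hy

theorem inner_eq_of_mem_Fop {b lam : Fin m → ℝ} {D : Finset (Fin m)} (hDM : D ∈ Mcb a c b)
    (hD : ∀ t ∉ D, lam t = 0) (hc : -c = ∑ t, lam t • a t) {x : EuclideanSpace ℝ (Fin n)}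
    (hx : x ∈ Fop a c b) : ⟪c, x⟫ = -∑ t, lam t * b t := by
  obtain ⟨y, hy, hact, -⟩ := hDM
  rw [← inner_eq_neg_sum_mul hD hc hact]
  exact le_antisymm (hx.2 y hy.1) (hy.2 x hx.1)

theorem isClosed_setOf_mem_Mcb (D : Finset (Fin m)) :
    IsClosed {b : Fin m → ℝ | D ∈ Mcb a c b} := by
  simp only [mem_Mcb_iff]
  refine IsClosed.inter isClosed_const ?_
  have h := (isClosed_setOf_exists_inner_le (Sum.elim a (fun t : D => -a t))).preimage
    (f := fun b : Fin m → ℝ => Sum.elim b (fun t : D => -b t)) (by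
      refine continuous_pi ?_
      rintro (t | t)
      · exact continuous_apply t
      · exact (continuous_apply (t : Fin m)).neg)
  refine (congrArg IsClosed (Set.ext fun b => ?_)).mpr h
  change (∃ x, (∀ t, ⟪a t, x⟫ ≤ b t) ∧ ∀ t ∈ D, ⟪a t, x⟫ = b t) ↔ _
  simp only [mem_ofPred_eq, mem_preimage, Sum.forall, Sum.elim_inl, Sum.elim_inr, inner_neg_left,
    neg_le_neg_iff, Subtype.forall]
  refine exists_congr fun x => and_congr_right fun hx => forall₂_congr fun t ht => ?_
  exact ⟨fun h => h.ge, fun h => le_antisymm (hx t) h⟩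

theorem isClosed_Fop (b : Fin m → ℝ) : IsClosed (Fop a c b) := by
  simp only [Fop, Feas, ofPred_and, ofPred_forall]
  refine IsClosed.inter (isClosed_iInter fun t => ?_)
    (isClosed_iInter fun y => isClosed_iInter fun _ => ?_)
  · exact isClosed_le (by fun_prop) (by fun_prop)
  · exact isClosed_le (by fun_prop) (by fun_prop)

theorem Fop_nonempty {b : Fin m → ℝ} (hc : InCone a Finset.univ (-c))
    (hb : (Feas a b).Nonempty) : (Fop a c b).Nonempty := by
  obtain ⟨lam, h0, -, hc⟩ := hc
  set S : Set ℝ := {γ | ∃ x ∈ Feas a b, ⟪c, x⟫ ≤ γ} with hS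
  have hclosed : IsClosed S := by
    have h := (isClosed_setOf_exists_inner_le (Sum.elim a (fun _ : Unit => c))).preimage
      (f := fun γ : ℝ => Sum.elim b (fun _ : Unit => γ)) (by
        refine continuous_pi ?_
        rintro (t | t)
        · exact continuous_const
        · exact continuous_id)
    convert h using 1
    refine Set.ext fun γ => ?_
    simp [hS, Feas]
  have hbdd : BddBelow S := ⟨-∑ t, lam t * b t, by
    rintro γ ⟨x, hx, hγ⟩
    exact (neg_sum_mul_le_inner h0 hc hx).trans hγ⟩
  obtain ⟨x₀, hx₀⟩ := hb
  obtain ⟨x, hx, hle⟩ := hclosed.csInf_mem ⟨⟪c, x₀⟫, x₀, hx₀, le_rfl⟩ hbdd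
  exact ⟨x, hx, fun y hy => hle.trans (csInf_le hbdd ⟨y, hy, le_rfl⟩)⟩

open Classical in
theorem inCone_activeSet {b : Fin m → ℝ} {x : EuclideanSpace ℝ (Fin n)} (hx : x ∈ Fop a c b) :
    InCone a (Finset.univ.filter (· ∈ activeSet a b x)) (-c) := by
  set A := Finset.univ.filter (· ∈ activeSet a b x) with hA
  let C : ProperCone ℝ (EuclideanSpace ℝ (Fin n)) :=
    { carrier := {z | ∃ lam : A → ℝ, (∀ i, 0 ≤ lam i) ∧ z = ∑ i, lam i • a i}
      add_mem' := by
        rintro _ _ ⟨l, hl, rfl⟩ ⟨l', hl', rfl⟩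
        exact ⟨l + l', fun i => add_nonneg (hl i) (hl' i), by
          simp [add_smul, Finset.sum_add_distrib]⟩
      zero_mem' := ⟨0, fun _ => le_rfl, by simp⟩
      smul_mem' := by
        rintro r _ ⟨l, hl, rfl⟩
        refine ⟨fun i => r.1 * l i, fun i => mul_nonneg r.2 (hl i), ?_⟩
        simp only [mul_smul, ← Finset.smul_sum]
        rfl
      isClosed' := isClosed_conicCombinations (fun i : A => a i) }
  by_cases hmem : -c ∈ C
  · obtain ⟨lam, hlam, heq⟩ := hmem
    refine ⟨fun i => if h : i ∈ A then lam ⟨i, h⟩ else 0, fun i => ?_, fun i hi => by simp [hi], ?_⟩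
    · dsimp only
      split_ifs
      · exact hlam _
      · exact le_rfl
    · rw [heq, ← Finset.sum_subset (Finset.subset_univ A) (fun i _ hi => by simp [hi]),
        ← Finset.sum_coe_sort A]
      simp
  exfalso
  obtain ⟨y, hy, hcy⟩ := C.hyperplane_separation' hmem
  have hay : ∀ t ∈ A, 0 ≤ ⟪a t, y⟫ := fun t ht => hy (a t) ⟨Pi.single ⟨t, ht⟩ 1, fun i => by
    by_cases h : i = ⟨t, ht⟩
    · subst h; simp
    · simp [h], by
    rw [Finset.sum_eq_single ⟨t, ht⟩ (by intro k _ hk; simp [hk]) (by simp)]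
    simp⟩
  have hev : ∀ᶠ ε in nhdsWithin (0 : ℝ) (Ioi 0), ∀ t, ⟪a t, x - ε • y⟫ ≤ b t := by
    refine eventually_all.2 fun t => ?_
    by_cases ht : t ∈ A
    · filter_upwards [self_mem_nhdsWithin] with ε hε
      rw [inner_sub_right, real_inner_smul_right]
      have := hx.1 t
      have := mul_nonneg (le_of_lt hε) (hay t ht)
      linarith
    · have hlt : ⟪a t, x⟫ < b t :=
        lt_of_le_of_ne (hx.1 t) (fun h => ht (by simpa [hA] using! h))
      have hcont : ContinuousAt (fun ε : ℝ => ⟪a t, x - ε • y⟫) 0 := by fun_prop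
      have := hcont.eventually_lt (g := fun _ => b t) continuousAt_const (by simpa using hlt)
      filter_upwards [nhdsWithin_le_nhds this] with ε hε using hε.le
  have hpos : ∀ᶠ ε in nhdsWithin (0 : ℝ) (Ioi 0), 0 < ε := self_mem_nhdsWithin
  obtain ⟨ε, hε, hfeas⟩ := (hpos.and hev).exists
  have := hx.2 _ hfeas
  rw [inner_sub_right, real_inner_smul_right] at this
  rw [inner_neg_left] at hcy
  have := mul_pos hε (neg_neg_iff_pos.1 hcy)
  linarith

theorem Mcb_nonempty {b : Fin m → ℝ} (hc : InCone a Finset.univ (-c))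
    (hb : (Feas a b).Nonempty) : (Mcb a c b).Nonempty := by
  classical
  obtain ⟨x, hx⟩ := Fop_nonempty hc hb
  obtain ⟨D, hDA, hD⟩ := (Set.toFinite {D : Finset (Fin m) | InCone a D (-c)}).exists_le_minimal
    (inCone_activeSet hx)
  refine ⟨D, x, hx, fun t ht => ?_, hD.prop, fun D' hsub hD' => ?_⟩
  · simpa using hDA ht
  · exact hsub.antisymm (hD.le_of_le hD' hsub)

theorem lineMap_mem_Fop {b₀ b₁ : Fin m → ℝ} {D : Finset (Fin m)} (h₀ : D ∈ Mcb a c b₀)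
    (h₁ : D ∈ Mcb a c b₁) {z x : EuclideanSpace ℝ (Fin n)} (hz : z ∈ Fop a c b₀)
    (hx : x ∈ Fop a c b₁) {s : ℝ} (hs : s ∈ Icc (0 : ℝ) 1) :
    AffineMap.lineMap z x s ∈ Fop a c (AffineMap.lineMap b₀ b₁ s) := by
  obtain ⟨lam, hlam, hD, hc⟩ := (mem_Mcb_iff.1 h₀).1.1
  have hfeas : AffineMap.lineMap z x s ∈ Feas a (AffineMap.lineMap b₀ b₁ s) := by
    intro t
    have e₀ := mul_le_mul_of_nonneg_left (hz.1 t) (sub_nonneg.2 hs.2)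
    have e₁ := mul_le_mul_of_nonneg_left (hx.1 t) hs.1
    simp only [AffineMap.lineMap_apply_module, inner_add_right, real_inner_smul_right,
      Pi.add_apply, Pi.smul_apply, smul_eq_mul]
    linarith
  refine ⟨hfeas, fun y hy => le_trans (le_of_eq ?_) (neg_sum_mul_le_inner hlam hc hy)⟩
  simp only [AffineMap.lineMap_apply_module, inner_add_right, real_inner_smul_right,
    inner_eq_of_mem_Fop h₀ hD hc hz, inner_eq_of_mem_Fop h₁ hD hc hx,
    Pi.add_apply, Pi.smul_apply, smul_eq_mul, mul_add, Finset.sum_add_distrib]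
  simp only [mul_left_comm (lam _), ← Finset.mul_sum]
  ring

theorem Feas_segment_nonempty {bbar b : Fin m → ℝ} (hbbar : (Feas a bbar).Nonempty)
    (hb : (Feas a b).Nonempty) {s : ℝ} (hs : s ∈ Icc (0 : ℝ) 1) :
    (Feas a (bbar + s • (b - bbar))).Nonempty := by
  obtain ⟨z, hz⟩ := hbbar
  obtain ⟨x, hx⟩ := hb
  refine ⟨z + s • (x - z), fun t => ?_⟩
  have e₀ := mul_le_mul_of_nonneg_left (hz t) (sub_nonneg.2 hs.2)
  have e₁ := mul_le_mul_of_nonneg_left (hx t) hs.1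
  simp only [inner_add_right, inner_sub_right, real_inner_smul_right, Pi.add_apply,
    Pi.smul_apply, Pi.sub_apply, smul_eq_mul]
  linarith

theorem exists_mem_Mcb_endpoints (hc : InCone a Finset.univ (-c)) {bbar b : Fin m → ℝ}
    (hbbar : (Feas a bbar).Nonempty) (hb : (Feas a b).Nonempty) {p q : ℝ} (hp : 0 ≤ p)
    (hq : q ≤ 1) (hpq : p < q) (hbreak : ∀ ν ∈ Ioo p q, ν ∉ BreakSet a c bbar b) :
    ∃ D, D ∈ Mcb a c (bbar + p • (b - bbar)) ∧ D ∈ Mcb a c (bbar + q • (b - bbar)) := by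
  obtain ⟨r, hr⟩ := exists_between hpq
  obtain ⟨D, hD⟩ := Mcb_nonempty hc
    (Feas_segment_nonempty hbbar hb (s := r) ⟨hp.trans hr.1.le, hr.2.le.trans hq⟩)
  have hclosed : ∀ D' : Finset (Fin m), IsClosed {ν : ℝ | D' ∈ Mcb a c (bbar + ν • (b - bbar))} :=
    fun D' => (isClosed_setOf_mem_Mcb D').preimage
      (f := fun ν : ℝ => bbar + ν • (b - bbar)) (by fun_prop)
  set S := {ν : ℝ | D ∈ Mcb a c (bbar + ν • (b - bbar))} with hS
  have hloc : S ∩ Ioo p q ⊆ interior S := by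
    rintro ν ⟨hνS, hν⟩
    rw [mem_interior_iff_mem_nhds]
    by_contra hnot
    have hsub : ∀ᶠ ξ in nhds ν, ∀ D', D' ∈ Mcb a c (bbar + ξ • (b - bbar)) →
        D' ∈ Mcb a c (bbar + ν • (b - bbar)) := by
      refine eventually_all.2 fun D' => ?_
      by_cases hD' : D' ∈ Mcb a c (bbar + ν • (b - bbar))
      · exact Eventually.of_forall fun _ _ => hD'
      · filter_upwards [(hclosed D').isOpen_compl.mem_nhds hD'] with ξ hξ h using absurd h hξ
    have hfreq : ∃ᶠ ξ in nhds ν,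
        Mcb a c (bbar + ξ • (b - bbar)) ⊂ Mcb a c (bbar + ν • (b - bbar)) := by
      have hnotin : ∃ᶠ ξ in nhds ν, ξ ∉ S := fun h => hnot (by simpa using h)
      refine (hnotin.and_eventually hsub).mono ?_
      rintro ξ ⟨hξS, hξ⟩
      exact ⟨hξ, fun h => hξS (h hνS)⟩
    obtain ⟨u, hu, hlim⟩ := exists_seq_forall_of_frequently hfreq
    exact hbreak ν hν ⟨⟨hp.trans_lt hν.1, hν.2.trans_le hq⟩, u, hu, hlim⟩
  have hIoo : Ioo p q ⊆ interior S := by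
    refine isPreconnected_Ioo.subset_of_closure_inter_subset isOpen_interior
      ⟨r, hr, hloc ⟨hD, hr⟩⟩ ?_
    rintro ν ⟨hν, hνI⟩
    exact hloc ⟨closure_minimal interior_subset (hclosed D) hν, hνI⟩
  have hIcc : Icc p q ⊆ S := by
    rw [← closure_Ioo hpq.ne]
    exact closure_minimal (hIoo.trans interior_subset) (hclosed D)
  exact ⟨D, hIcc (left_mem_Icc.2 hpq.le), hIcc (right_mem_Icc.2 hpq.le)⟩

theorem edist_lineMap_left_of_nonneg {E : Type*} [NormedAddCommGroup E] [NormedSpace ℝ E]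
    (z x : E) {s : ℝ} (hs : 0 ≤ s) : edist (AffineMap.lineMap z x s) z = ENNReal.ofReal s * edist x z := by
  rw [edist_dist, dist_lineMap_left, ENNReal.ofReal_mul (norm_nonneg _), Real.norm_of_nonneg hs,
    ← edist_dist, edist_comm z x]

theorem exists_edist_le_lipuscMod_mul {b₀ b₁ : Fin m → ℝ} (hne : b₁ ≠ b₀) {D : Finset (Fin m)}
    (h₀ : D ∈ Mcb a c b₀) (h₁ : D ∈ Mcb a c b₁) {x : EuclideanSpace ℝ (Fin n)}
    (hx : x ∈ Fop a c b₁) :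
    ∃ z ∈ Fop a c b₀, edist x z ≤ lipuscMod (fun b' => Fop a c b') b₀ * edist b₁ b₀ := by
  have hnon : (Fop a c b₀).Nonempty := by
    obtain ⟨y, hy, -⟩ := h₀
    exact ⟨y, hy⟩
  obtain ⟨z, hz, hdist⟩ := (isClosed_Fop b₀).exists_infDist_eq_dist hnon x
  refine ⟨z, hz, ?_⟩
  have hE0 : edist b₁ b₀ ≠ 0 := by simpa using hne
  have hEt : edist b₁ b₀ ≠ ⊤ := edist_ne_top _ _
  rw [← ENNReal.div_le_iff hE0 hEt]
  have htend : Tendsto (fun s : ℝ => AffineMap.lineMap b₀ b₁ s) (nhdsWithin 0 (Ioi 0))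
      (nhds b₀) := by
    have : Continuous (fun s : ℝ => (AffineMap.lineMap b₀ b₁ s : Fin m → ℝ)) := by fun_prop
    simpa using (this.tendsto 0).mono_left nhdsWithin_le_nhds
  refine le_limsup_of_frequently_le' (htend.frequently (Eventually.frequently ?_))
  filter_upwards [Ioc_mem_nhdsGT (zero_lt_one' ℝ)] with s hs
  have hinf : ENNReal.ofReal s * edist x z ≤
      Metric.infEDist (AffineMap.lineMap z x s) (Fop a c b₀) := by
    have htri := Metric.infDist_le_infDist_add_dist (s := Fop a c b₀) (x := x)
      (y := AffineMap.lineMap z x s)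
    rw [hdist, dist_right_lineMap, Real.norm_of_nonneg (sub_nonneg.2 hs.2), dist_comm z x] at htri
    rw [edist_dist, ← ENNReal.ofReal_mul hs.1.le]
    refine (ENNReal.ofReal_le_ofReal (q := Metric.infDist (AffineMap.lineMap z x s)
      (Fop a c b₀)) (by linarith)).trans ?_
    rw [Metric.infDist, ENNReal.ofReal_toReal (Metric.infEDist_ne_top hnon)]
  have hs0 : ENNReal.ofReal s ≠ 0 := by simpa using hs.1
  calc edist x z / edist b₁ b₀
      = (ENNReal.ofReal s * edist x z) / (ENNReal.ofReal s * edist b₁ b₀) :=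
        (ENNReal.mul_div_mul_left _ _ hs0 ENNReal.ofReal_ne_top).symm
    _ ≤ Metric.infEDist (AffineMap.lineMap z x s) (Fop a c b₀) /
          edist (AffineMap.lineMap b₀ b₁ s) b₀ := by
        rw [edist_lineMap_left_of_nonneg _ _ hs.1.le]
        gcongr
    _ ≤ _ := le_iSup₂_of_le (AffineMap.lineMap z x s)
        (lineMap_mem_Fop h₀ h₁ hz hx ⟨hs.1.le, hs.2⟩) le_rfl

end LinearProgram

/-- Assume `−c̄ ∈ cone{a_t : t ∈ T}`. Let `b, b̄ ∈ dom F` with `b ≠ b̄`,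
and write `B(b̄,b) = {μ_1,…,μ_N}` with `0 := μ_0 < μ_1 < … < μ_N < μ_{N+1} := 1`. Then for
every `x ∈ F_c̄^op(b)`,
`d(x, F_c̄^op(b̄))/d(b,b̄) ≤ max{Lipusc F_c̄^op(b̄ + μ_k(b−b̄)) : k = 0,…,N}`. -/
theorem ratio_le_max_lipusc_break_steps {n m : ℕ} (a : Fin m → EuclideanSpace ℝ (Fin n))
    (cbar : EuclideanSpace ℝ (Fin n)) (hc : InCone a Finset.univ (-cbar))
    (bbar b : Fin m → ℝ)
    (hbbar : (Feas a bbar).Nonempty) (hb : (Feas a b).Nonempty) (hne : b ≠ bbar)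
    (N : ℕ) (μ : ℕ → ℝ) (hμ0 : μ 0 = 0) (hμlast : μ (N + 1) = 1)
    (hmono : ∀ i ≤ N, μ i < μ (i + 1))
    (henum : BreakSet a cbar bbar b = μ '' {i : ℕ | 1 ≤ i ∧ i ≤ N}) :
    ∀ x ∈ Fop a cbar b,
      EMetric.infEdist x (Fop a cbar bbar) / edist b bbar ≤
        ⨆ k ∈ Finset.range (N + 1),
          lipuscMod (fun b' => Fop a cbar b') (bbar + μ k • (b - bbar)) := by
  intro x hx
  have hmono' : ∀ i j, i ≤ j → j ≤ N + 1 → μ i ≤ μ j := by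
    intro i j hij
    induction j, hij using Nat.le_induction with
    | base => exact fun _ => le_rfl
    | succ j _ ih => exact fun hj => (ih (by omega)).trans (hmono j (by omega)).le
  set L := ⨆ k ∈ Finset.range (N + 1),
    lipuscMod (fun b' => Fop a cbar b') (bbar + μ k • (b - bbar)) with hL
  have hchain : ∀ k ≤ N + 1, ∀ y ∈ Fop a cbar (bbar + μ k • (b - bbar)),
      Metric.infEDist y (Fop a cbar bbar) ≤ L * (ENNReal.ofReal (μ k) * edist b bbar) := by
    intro k
    induction k with
    | zero =>
      intro _ y hy
      rw [hμ0, zero_smul, add_zero] at hy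
      simp [Metric.infEDist_zero_of_mem hy]
    | succ k ih =>
      intro hk y hy
      have hlt := hmono k (by omega)
      have h0 : 0 ≤ μ k := hμ0 ▸ hmono' 0 k (by omega) (by omega)
      have h1 : μ (k + 1) ≤ 1 := hμlast ▸ hmono' (k + 1) (N + 1) hk le_rfl
      have hbreak : ∀ ν ∈ Ioo (μ k) (μ (k + 1)), ν ∉ BreakSet a cbar bbar b := by
        intro ν hν hνB
        rw [henum] at hνB
        obtain ⟨i, hi, rfl⟩ := hνB
        rcases Nat.lt_or_ge k i with h | h
        · exact absurd (hmono' (k + 1) i h (by have := hi.2; omega)) (not_le.2 hν.2)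
        · exact absurd (hmono' i k h (by omega)) (not_le.2 hν.1)
      obtain ⟨D, hD₀, hD₁⟩ := exists_mem_Mcb_endpoints hc hbbar hb h0 h1 hlt hbreak
      have hsub : (bbar + μ (k + 1) • (b - bbar)) - (bbar + μ k • (b - bbar)) =
          (μ (k + 1) - μ k) • (b - bbar) := by
        rw [sub_smul]; abel
      have hedist : edist (bbar + μ (k + 1) • (b - bbar)) (bbar + μ k • (b - bbar)) =
          ENNReal.ofReal (μ (k + 1) - μ k) * edist b bbar := by
        rw [edist_dist, dist_eq_norm, hsub, norm_smul, ENNReal.ofReal_mul (norm_nonneg _),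
          Real.norm_of_nonneg (sub_nonneg.2 hlt.le), edist_dist, dist_eq_norm]
      have hne' : bbar + μ (k + 1) • (b - bbar) ≠ bbar + μ k • (b - bbar) := by
        rw [← sub_ne_zero, hsub]
        exact smul_ne_zero (sub_pos.2 hlt).ne' (sub_ne_zero.2 hne)
      obtain ⟨z, hz, hyz⟩ := exists_edist_le_lipuscMod_mul hne' hD₀ hD₁ hy
      have hle : lipuscMod (fun b' => Fop a cbar b') (bbar + μ k • (b - bbar)) ≤ L :=
        le_iSup₂_of_le (f := fun k (_ : k ∈ Finset.range (N + 1)) =>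
          lipuscMod (fun b' => Fop a cbar b') (bbar + μ k • (b - bbar))) k
          (Finset.mem_range.2 (by omega)) le_rfl
      calc Metric.infEDist y (Fop a cbar bbar)
          ≤ Metric.infEDist z (Fop a cbar bbar) + edist y z := Metric.infEDist_le_infEDist_add_edist
        _ ≤ L * (ENNReal.ofReal (μ k) * edist b bbar) +
            L * (ENNReal.ofReal (μ (k + 1) - μ k) * edist b bbar) := by
            refine add_le_add (ih (by omega) z hz) (hyz.trans ?_)
            rw [hedist]
            gcongr
        _ = L * (ENNReal.ofReal (μ (k + 1)) * edist b bbar) := by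
            rw [← mul_add, ← add_mul, ← ENNReal.ofReal_add h0 (sub_nonneg.2 hlt.le),
              add_sub_cancel]
  refine ENNReal.div_le_of_le_mul ?_
  have := hchain (N + 1) le_rfl x (by simpa [hμlast] using hx)
  rwa [hμlast, ENNReal.ofReal_one, one_mul] at this
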